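/- Let Φ⁺ be the 2-qubit state with Φ⁺ s = 1/√2 if s 0 = s 1 and 0 otherwise, and let Φ⁻ be the 2-qubit state with Φ⁻ s = 1/√2 if s 0 = s 1 = 0, Φ⁻ s = −1/√2 if s 0 = s 1 = 1, and 0 otherwise. For every pair of local observables A, B, the measurement scenario giving each of the two parties the choice set {A, B} yields an empirical model of Φ⁺ that is not logically contextual, and likewise for Φ⁻: for every context c and every joint outcome o possible in c, there exists a consistent global assignment g with g i (c i) = o i for both parties i. -/

import Mathlib

open Complex Finset

/-- A local observable: a pair of vectors forming an orthonormal basis of ℂ². -/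
structure Obs where
  eplus : Fin 2 → ℂ
  eminus : Fin 2 → ℂ
  norm_plus : ∑ a : Fin 2, ‖eplus a‖ ^ 2 = 1
  norm_minus : ∑ a : Fin 2, ‖eminus a‖ ^ 2 = 1
  orth : ∑ a : Fin 2, (starRingEnd ℂ) (eplus a) * eminus a = 0

/-- Probability that context `c` yields joint outcome `o` on state `ψ`. -/
noncomputable def jointProb {n : ℕ} (ψ : (Fin n → Fin 2) → ℂ) (c : Fin n → Obs)
    (o : Fin n → Bool) : ℝ :=
  ‖∑ s : Fin n → Fin 2,
      (∏ i : Fin n,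
        (starRingEnd ℂ) ((if o i then (c i).eplus else (c i).eminus) (s i))) * ψ s‖ ^ 2

/-- A global assignment `g` is consistent if in every context of the scenario `M`
the induced joint outcome is possible. -/
def Consistent {n : ℕ} (ψ : (Fin n → Fin 2) → ℂ) (M : Fin n → Set Obs)
    (g : Fin n → Obs → Bool) : Prop :=
  ∀ c : Fin n → Obs, (∀ i, c i ∈ M i) → jointProb ψ c (fun i => g i (c i)) ≠ 0

def StronglyContextual {n : ℕ} (ψ : (Fin n → Fin 2) → ℂ) (M : Fin n → Set Obs) : Prop :=
  ¬ ∃ g : Fin n → Obs → Bool, Consistent ψ M g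

def LogicallyContextual {n : ℕ} (ψ : (Fin n → Fin 2) → ℂ) (M : Fin n → Set Obs) : Prop :=
  ∃ c : Fin n → Obs, (∀ i, c i ∈ M i) ∧ ∃ o : Fin n → Bool,
    jointProb ψ c o ≠ 0 ∧
    ¬ ∃ g : Fin n → Obs → Bool, Consistent ψ M g ∧ ∀ i, g i (c i) = o i

/-- The Pauli Z observable. -/
noncomputable def pauliZ : Obs where
  eplus := ![1, 0]
  eminus := ![0, 1]
  norm_plus := by simp [Fin.sum_univ_two]
  norm_minus := by simp [Fin.sum_univ_two]
  orth := by simp [Fin.sum_univ_two]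

/-- The Pauli Y observable. -/
noncomputable def pauliY : Obs where
  eplus := ![((Real.sqrt 2)⁻¹ : ℝ), ((Real.sqrt 2)⁻¹ : ℝ) * Complex.I]
  eminus := ![((Real.sqrt 2)⁻¹ : ℝ), -(((Real.sqrt 2)⁻¹ : ℝ) * Complex.I)]
  norm_plus := by
    have h : ‖(((Real.sqrt 2)⁻¹ : ℝ) : ℂ)‖ ^ 2 = 1 / 2 := by
      rw [Complex.norm_real, Real.norm_eq_abs, _root_.sq_abs, inv_pow,
        Real.sq_sqrt (by norm_num : (0:ℝ) ≤ 2)]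
      norm_num
    simp [Fin.sum_univ_two, norm_mul, h]
    norm_num [h]
  norm_minus := by
    have h : ‖(((Real.sqrt 2)⁻¹ : ℝ) : ℂ)‖ ^ 2 = 1 / 2 := by
      rw [Complex.norm_real, Real.norm_eq_abs, _root_.sq_abs, inv_pow,
        Real.sq_sqrt (by norm_num : (0:ℝ) ≤ 2)]
      norm_num
    simp [Fin.sum_univ_two, norm_mul, h]
    norm_num [h]
  orth := by
    have h : ((starRingEnd ℂ) (((Real.sqrt 2)⁻¹ : ℝ) : ℂ)) = (((Real.sqrt 2)⁻¹ : ℝ) : ℂ) :=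
      Complex.conj_ofReal _
    simp [Fin.sum_univ_two, map_mul, Complex.conj_I, h]
    linear_combination (((Real.sqrt 2 : ℝ) : ℂ))⁻¹ * (((Real.sqrt 2 : ℝ) : ℂ))⁻¹ * Complex.I_mul_I

/-- The Pauli X observable. -/
noncomputable def pauliX : Obs where
  eplus := ![((Real.sqrt 2)⁻¹ : ℝ), ((Real.sqrt 2)⁻¹ : ℝ)]
  eminus := ![((Real.sqrt 2)⁻¹ : ℝ), -(((Real.sqrt 2)⁻¹ : ℝ) : ℂ)]
  norm_plus := by
    have h : ‖(((Real.sqrt 2)⁻¹ : ℝ) : ℂ)‖ ^ 2 = 1 / 2 := by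
      rw [Complex.norm_real, Real.norm_eq_abs, _root_.sq_abs, inv_pow,
        Real.sq_sqrt (by norm_num : (0:ℝ) ≤ 2)]
      norm_num
    simp [Fin.sum_univ_two, h]
    norm_num [h]
  norm_minus := by
    have h : ‖(((Real.sqrt 2)⁻¹ : ℝ) : ℂ)‖ ^ 2 = 1 / 2 := by
      rw [Complex.norm_real, Real.norm_eq_abs, _root_.sq_abs, inv_pow,
        Real.sq_sqrt (by norm_num : (0:ℝ) ≤ 2)]
      norm_num
    simp [Fin.sum_univ_two, h]
    norm_num [h]
  orth := by
    have h : ((starRingEnd ℂ) (((Real.sqrt 2)⁻¹ : ℝ) : ℂ)) = (((Real.sqrt 2)⁻¹ : ℝ) : ℂ) :=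
      Complex.conj_ofReal _
    simp [Fin.sum_univ_two, h]

/-- The Bell state `Φ⁺ = (|00⟩ + |11⟩)/√2`. -/
noncomputable def PhiPlus : (Fin 2 → Fin 2) → ℂ := fun s =>
  if s 0 = s 1 then (((Real.sqrt 2)⁻¹ : ℝ) : ℂ) else 0

/-- The Bell state `Φ⁻ = (|00⟩ - |11⟩)/√2`. -/
noncomputable def PhiMinus : (Fin 2 → Fin 2) → ℂ := fun s =>
  if s 0 = 0 ∧ s 1 = 0 then (((Real.sqrt 2)⁻¹ : ℝ) : ℂ)
  else if s 0 = 1 ∧ s 1 = 1 then (-((Real.sqrt 2)⁻¹ : ℝ) : ℂ) else 0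

/-- Vector of the outcome `x` of the observable `X`. -/
def ovec (X : Obs) (x : Bool) : Fin 2 → ℂ := if x then X.eplus else X.eminus

/-- The bilinear form attached to the Bell state with sign `ε`. -/
def bform (ε : ℂ) (u v : Fin 2 → ℂ) : ℂ := u 0 * v 0 + ε * (u 1 * v 1)

/-- Whether outcomes of parity `r` are possible for the pair `X`, `Y`. -/
def qpar (ε : ℂ) (X Y : Obs) (r : Bool) : Prop :=
  if r then X.eplus 0 * Y.eplus 0 + ε * (X.eplus 1 * Y.eplus 1) ≠ 0
  else X.eplus 0 * star (Y.eplus 1) - ε * (X.eplus 1 * star (Y.eplus 0)) ≠ 0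

lemma sum_fin2_fun (f : (Fin 2 → Fin 2) → ℂ) :
    ∑ s, f s = f ![0, 0] + f ![0, 1] + f ![1, 0] + f ![1, 1] := by
  rw [← (finTwoArrowEquiv (Fin 2)).symm.sum_comp, Fintype.sum_prod_type]
  simp [Fin.sum_univ_two, finTwoArrowEquiv]
  ring

lemma sq2_ne : ((((Real.sqrt 2)⁻¹ : ℝ)) : ℂ) ≠ 0 := by
  rw [Complex.ofReal_ne_zero]; positivity

lemma amp_ne (ε : ℂ) (hε : star ε = ε) (k : ℂ) (hk : k ≠ 0) (u v : Fin 2 → ℂ) (z : ℂ)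
    (hz : z = k * (starRingEnd ℂ) (bform ε u v)) : ‖z‖ ^ 2 ≠ 0 ↔ bform ε u v ≠ 0 := by
  subst hz
  simp [hk]

lemma jp_plus (c : Fin 2 → Obs) (o : Fin 2 → Bool) :
    jointProb PhiPlus c o ≠ 0 ↔ bform 1 (ovec (c 0) (o 0)) (ovec (c 1) (o 1)) ≠ 0 := by
  unfold jointProb
  apply amp_ne 1 (by simp) _ sq2_ne
  rw [sum_fin2_fun]
  simp only [Fin.prod_univ_two, PhiPlus, bform, ovec]
  simp
  ring

lemma jp_minus (c : Fin 2 → Obs) (o : Fin 2 → Bool) :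
    jointProb PhiMinus c o ≠ 0 ↔ bform (-1) (ovec (c 0) (o 0)) (ovec (c 1) (o 1)) ≠ 0 := by
  unfold jointProb
  apply amp_ne (-1) (by simp) _ sq2_ne
  rw [sum_fin2_fun]
  simp only [Fin.prod_univ_two, PhiMinus, bform, ovec]
  simp
  ring

lemma nrm_star_eq (u : Fin 2 → ℂ) (h : ∑ a : Fin 2, ‖u a‖ ^ 2 = 1) :
    u 0 * star (u 0) + u 1 * star (u 1) = 1 := by
  rw [Fin.sum_univ_two] at h
  have h' := congrArg (fun x : ℝ => (x : ℂ)) h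
  push_cast at h'
  rw [← h', ← Complex.mul_conj', ← Complex.mul_conj']
  rfl

lemma obs_minus (X : Obs) : ∃ l : ℂ, l ≠ 0 ∧ X.eminus 0 = - l * star (X.eplus 1) ∧
    X.eminus 1 = l * star (X.eplus 0) := by
  have h1 := nrm_star_eq _ X.norm_plus
  have h2 := nrm_star_eq _ X.norm_minus
  have h3 : star (X.eplus 0) * X.eminus 0 + star (X.eplus 1) * X.eminus 1 = 0 := by
    have := X.orth
    rwa [Fin.sum_univ_two] at this
  have e0 : X.eminus 0 = - (X.eplus 0 * X.eminus 1 - X.eplus 1 * X.eminus 0)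
      * star (X.eplus 1) := by
    linear_combination (-X.eminus 0) * h1 + X.eplus 0 * h3
  have e1 : X.eminus 1 = (X.eplus 0 * X.eminus 1 - X.eplus 1 * X.eminus 0)
      * star (X.eplus 0) := by
    linear_combination (-X.eminus 1) * h1 + X.eplus 1 * h3
  refine ⟨_, ?_, e0, e1⟩
  intro h
  rw [h] at e0 e1
  rw [e0, e1] at h2
  simp at h2

lemma poss_iff (ε : ℂ) (hs : star ε = ε) (he : ε * ε = 1) (X Y : Obs) (x y : Bool) :
    bform ε (ovec X x) (ovec Y y) ≠ 0 ↔ qpar ε X Y (x == y) := by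
  obtain ⟨l, hl, l0, l1⟩ := obs_minus X
  obtain ⟨m, hm, m0, m1⟩ := obs_minus Y
  have hε : ε ≠ 0 := by rintro rfl; simp at he
  have tf : (true == false) = false := rfl
  have ft : (false == true) = false := rfl
  cases x <;> cases y <;> simp only [bform, ovec, qpar, tf, ft] <;> simp only [beq_self_eq_true,
    if_true, Bool.false_eq_true, if_false,
    l0, l1, m0, m1] <;> rw [not_iff_not]
  · rw [show -l * star (X.eplus 1) * (-m * star (Y.eplus 1)) +
      ε * (l * star (X.eplus 0) * (m * star (Y.eplus 0))) =
      l * m * ε * star (X.eplus 0 * Y.eplus 0 + ε * (X.eplus 1 * Y.eplus 1)) by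
        simp only [star_add, star_mul, hs]
        linear_combination (-l * m * star (X.eplus 1) * star (Y.eplus 1)) * he]
    rw [mul_eq_zero, star_eq_zero]
    simp [hl, hm, hε]
  · rw [show -l * star (X.eplus 1) * Y.eplus 0 + ε * (l * star (X.eplus 0) * Y.eplus 1) =
      l * ε * star (X.eplus 0 * star (Y.eplus 1) - ε * (X.eplus 1 * star (Y.eplus 0))) by
        simp only [star_sub, star_mul, hs, star_star]
        linear_combination (l * star (X.eplus 1) * Y.eplus 0) * he]
    rw [mul_eq_zero, star_eq_zero]
    simp [hl, hε]
  · rw [show X.eplus 0 * (-m * star (Y.eplus 1)) + ε * (X.eplus 1 * (m * star (Y.eplus 0))) =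
      -m * (X.eplus 0 * star (Y.eplus 1) - ε * (X.eplus 1 * star (Y.eplus 0))) by ring]
    rw [mul_eq_zero]
    simp [hm]

lemma qpar_symm (ε : ℂ) (hs : star ε = ε) (he : ε * ε = 1) (X Y : Obs) (r : Bool) :
    qpar ε X Y r ↔ qpar ε Y X r := by
  have h1 := poss_iff ε hs he X Y r true
  have h2 := poss_iff ε hs he Y X true r
  rw [show bform ε (ovec Y true) (ovec X r) = bform ε (ovec X r) (ovec Y true) by
    unfold bform; ring, h1] at h2
  cases r <;> simpa using h2

lemma qpar_total (ε : ℂ) (hs : star ε = ε) (he : ε * ε = 1) (X Y : Obs) :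
    qpar ε X Y true ∨ qpar ε X Y false := by
  by_contra! h
  simp only [qpar] at h
  simp only [if_true, Bool.false_eq_true, if_false, not_not] at h
  obtain ⟨h1, h2⟩ := h
  have n1 := nrm_star_eq _ X.norm_plus
  have n2 := nrm_star_eq _ Y.norm_plus
  have a0 : X.eplus 0 = 0 := by
    linear_combination (-X.eplus 0) * n2 + star (Y.eplus 0) * h1 + Y.eplus 1 * h2
  have a1 : ε * X.eplus 1 = 0 := by
    linear_combination (-ε * X.eplus 1) * n2 + star (Y.eplus 1) * h1 - Y.eplus 0 * h2
  have a1' : X.eplus 1 = 0 := by linear_combination (-X.eplus 1) * he + ε * a1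
  simp [a0, a1'] at n1

lemma qpar_single (ε : ℂ) (hs : star ε = ε) (he : ε * ε = 1) (A B : Obs) (r : Bool)
    (hr : ¬ qpar ε A B r) (t : Bool) : qpar ε A A t ↔ qpar ε B B t := by
  have hε : ε ≠ 0 := by rintro rfl; simp at he
  have n1 := nrm_star_eq _ A.norm_plus
  have n2 := nrm_star_eq _ B.norm_plus
  cases r
  · simp only [qpar] at hr
    simp only [Bool.false_eq_true, if_false, not_not] at hr
    obtain ⟨k, k0, k1⟩ : ∃ k, B.eplus 0 = k * star (A.eplus 0) ∧
        B.eplus 1 = k * (ε * star (A.eplus 1)) := by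
      have hr' := congrArg star hr
      simp only [star_sub, star_mul, hs, star_star, star_zero] at hr'
      refine ⟨A.eplus 0 * B.eplus 0 + ε * (A.eplus 1 * B.eplus 1), ?_, ?_⟩
      · linear_combination (-B.eplus 0) * n1 - ε * A.eplus 1 * hr'
          - A.eplus 1 * star (A.eplus 1) * B.eplus 0 * he
      · linear_combination (-B.eplus 1) * n1 + A.eplus 0 * hr'
          - A.eplus 1 * star (A.eplus 1) * B.eplus 1 * he
    have hk : k ≠ 0 := by rintro rfl; simp [k0, k1] at n2
    cases t <;> simp only [qpar] <;> simp only [Bool.false_eq_true, if_false, if_true, k0, k1] <;>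
      rw [not_iff_not] <;> try simp only [star_mul, hs, star_star]
    · rw [show k * star (A.eplus 0) * (A.eplus 1 * ε * star k) -
        ε * (k * (ε * star (A.eplus 1)) * (A.eplus 0 * star k)) =
        -(k * star k) * (A.eplus 0 * star (A.eplus 1) - ε * (A.eplus 1 * star (A.eplus 0))) by
          linear_combination (- k * star k * star (A.eplus 1) * A.eplus 0) * he]
      rw [mul_eq_zero]
      simp [hk]
    · rw [show k * star (A.eplus 0) * (k * star (A.eplus 0)) +
        ε * (k * (ε * star (A.eplus 1)) * (k * (ε * star (A.eplus 1)))) =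
        (k * k) * star (A.eplus 0 * A.eplus 0 + ε * (A.eplus 1 * A.eplus 1)) by
          simp only [star_add, star_mul, hs]
          linear_combination (k * k * ε * star (A.eplus 1) * star (A.eplus 1)) * he]
      rw [mul_eq_zero, star_eq_zero]
      simp [hk]
  · simp only [qpar] at hr
    simp only [if_true, not_not] at hr
    obtain ⟨k, k0, k1⟩ : ∃ k, B.eplus 0 = k * (-ε * A.eplus 1) ∧
        B.eplus 1 = k * A.eplus 0 := by
      refine ⟨star (A.eplus 0) * B.eplus 1 - ε * (star (A.eplus 1) * B.eplus 0), ?_, ?_⟩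
      · linear_combination (-B.eplus 0) * n1 + star (A.eplus 0) * hr
          - A.eplus 1 * star (A.eplus 1) * B.eplus 0 * he
      · linear_combination (-B.eplus 1) * n1 + ε * star (A.eplus 1) * hr
          - A.eplus 1 * star (A.eplus 1) * B.eplus 1 * he
    have hk : k ≠ 0 := by rintro rfl; simp [k0, k1] at n2
    cases t <;> simp only [qpar] <;> simp only [Bool.false_eq_true, if_false, if_true, k0, k1] <;>
      rw [not_iff_not] <;> try simp only [star_mul, star_neg, hs]
    · rw [show k * (-ε * A.eplus 1) * (star (A.eplus 0) * star k) -
        ε * (k * A.eplus 0 * (star (A.eplus 1) * -ε * star k)) =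
        (k * star k) * (A.eplus 0 * star (A.eplus 1) - ε * (A.eplus 1 * star (A.eplus 0))) by
          linear_combination (k * star k * star (A.eplus 1) * A.eplus 0) * he]
      rw [mul_eq_zero]
      simp [hk]
    · rw [show k * (-ε * A.eplus 1) * (k * (-ε * A.eplus 1)) +
        ε * (k * A.eplus 0 * (k * A.eplus 0)) =
        (k * k * ε) * (A.eplus 0 * A.eplus 0 + ε * (A.eplus 1 * A.eplus 1)) by
          ring]
      rw [mul_eq_zero]
      simp [hk, hε]

/-- The combinatorial core: extension of a parity-possible pair along the 4-cycle. -/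
lemma comb_ext (p q s : Bool → Prop) (hp : p true ∨ p false) (hq : q true ∨ q false)
    (hs : s true ∨ s false) (h : ∀ r, ¬ q r → ∀ t, p t ↔ s t) (x y : Bool) :
    (p (x == y) → ∃ b0 b1, q (x == b1) ∧ q (b0 == y) ∧ s (b0 == b1)) ∧
    (q (x == y) → ∃ a1 b0, p (x == a1) ∧ q (b0 == a1) ∧ s (b0 == y)) := by
  have h1 := h true
  have h2 := h false
  clear h
  simp only [Bool.forall_bool] at h1 h2
  by_cases p1 : p true <;> by_cases p2 : p false <;> by_cases q1 : q true <;>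
    by_cases q2 : q false <;> by_cases s1 : s true <;> by_cases s2 : s false <;>
    simp only [p1, p2, q1, q2, s1, s2, not_true, not_false_iff, or_self, or_true, true_or,
      iff_true, iff_false, and_true, and_false, false_and, forall_true_left,
      imp_false] at hp hq hs h1 h2 <;>
    cases x <;> cases y <;> simp [p1, p2, q1, q2, s1, s2]

lemma main_aux (ε : ℂ) (hs : star ε = ε) (he : ε * ε = 1) (ψ : (Fin 2 → Fin 2) → ℂ)
    (hψ : ∀ (c : Fin 2 → Obs) (o : Fin 2 → Bool),
      jointProb ψ c o ≠ 0 ↔ bform ε (ovec (c 0) (o 0)) (ovec (c 1) (o 1)) ≠ 0)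
    (A B : Obs) (c : Fin 2 → Obs) (hc : ∀ i, c i ∈ ({A, B} : Set Obs)) (o : Fin 2 → Bool)
    (ho : jointProb ψ c o ≠ 0) :
    ∃ g : Fin 2 → Obs → Bool,
      Consistent ψ (fun _ => ({A, B} : Set Obs)) g ∧ ∀ i, g i (c i) = o i := by
  classical
  have hψ' : ∀ (c : Fin 2 → Obs) (o : Fin 2 → Bool),
      jointProb ψ c o ≠ 0 ↔ qpar ε (c 0) (c 1) (o 0 == o 1) :=
    fun c o => (hψ c o).trans (poss_iff ε hs he _ _ _ _)
  rw [hψ'] at ho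
  -- It suffices to treat observables `X`, `Y` with the first party measuring `X`.
  have key : ∀ X Y : Obs, ({A, B} : Set Obs) = {X, Y} → c 0 = X → (c 1 = X ∨ c 1 = Y ∧ Y ≠ X) →
      ∃ g : Fin 2 → Obs → Bool,
      Consistent ψ (fun _ => ({A, B} : Set Obs)) g ∧ ∀ i, g i (c i) = o i := by
    intro X Y hXY h0 h1
    have hcomb := comb_ext (qpar ε X X) (qpar ε X Y) (qpar ε Y Y) (qpar_total ε hs he _ _)
      (qpar_total ε hs he _ _) (qpar_total ε hs he _ _) (qpar_single ε hs he X Y) (o 0) (o 1)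
    have build : ∀ a1 b0 b1 : Bool, qpar ε X X (o 0 == a1) → qpar ε X Y (o 0 == b1) →
        qpar ε X Y (b0 == a1) → qpar ε Y Y (b0 == b1) →
        Consistent ψ (fun _ => ({A, B} : Set Obs))
          ![fun Z => if Z = X then o 0 else b0, fun Z => if Z = X then a1 else b1] := by
      intro a1 b0 b1 e1 e2 e3 e4 d hd
      rw [hψ']
      rw [qpar_symm ε hs he] at e3
      have d0 := hd 0
      have d1 := hd 1
      simp only [hXY, Set.mem_insert_iff, Set.mem_singleton_iff] at d0 d1
      by_cases f0 : d 0 = X <;> by_cases f1 : d 1 = X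
      · simpa [f0, f1] using e1
      · have := d1.resolve_left f1
        simp only [Matrix.cons_val_zero, Matrix.cons_val_one, f0, f1, if_true, if_false]
        rw [this]; exact e2
      · have := d0.resolve_left f0
        simp only [Matrix.cons_val_zero, Matrix.cons_val_one, f0, f1, if_true, if_false]
        rw [this]; exact e3
      · have g0 := d0.resolve_left f0
        have g1 := d1.resolve_left f1
        simp only [Matrix.cons_val_zero, Matrix.cons_val_one, f0, f1, if_false]
        rw [g0, g1]; exact e4
    rw [h0] at ho
    rcases h1 with h1 | ⟨h1, hne⟩
    · rw [h1] at ho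
      obtain ⟨b0, b1, e2, e3, e4⟩ := hcomb.1 ho
      refine ⟨_, build (o 1) b0 b1 ho e2 e3 e4, ?_⟩
      intro i
      fin_cases i <;> simp [h0, h1]
    · rw [h1] at ho
      obtain ⟨a1, b0, e2, e3, e4⟩ := hcomb.2 ho
      refine ⟨_, build a1 b0 (o 1) e2 ho e3 e4, ?_⟩
      intro i
      fin_cases i <;> simp [h0, h1, hne]
  have c0 := hc 0
  have c1 := hc 1
  simp only [Set.mem_insert_iff, Set.mem_singleton_iff] at c0 c1
  rcases c0 with c0 | c0
  · refine key A B rfl c0 ?_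
    by_cases hh : c 1 = A
    · exact Or.inl hh
    · have := c1.resolve_left hh
      exact Or.inr ⟨this, this ▸ hh⟩
  · refine key B A (Set.pair_comm A B) c0 ?_
    by_cases hh : c 1 = B
    · exact Or.inl hh
    · have := c1.resolve_right hh
      exact Or.inr ⟨this, this ▸ hh⟩

/-- For every pair of local observables `A`, `B`, the maximally entangled states `Φ⁺` and
`Φ⁻` are not logically contextual in the scenario where each party chooses from `{A, B}`:
every possible outcome of every context extends to a consistent global assignment. -/
theorem bellStates_not_logicallyContextual (A B : Obs) :
    (∀ c : Fin 2 → Obs, (∀ i, c i ∈ ({A, B} : Set Obs)) → ∀ o : Fin 2 → Bool,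
      jointProb PhiPlus c o ≠ 0 →
      ∃ g : Fin 2 → Obs → Bool,
        Consistent PhiPlus (fun _ => ({A, B} : Set Obs)) g ∧ ∀ i, g i (c i) = o i) ∧
    (∀ c : Fin 2 → Obs, (∀ i, c i ∈ ({A, B} : Set Obs)) → ∀ o : Fin 2 → Bool,
      jointProb PhiMinus c o ≠ 0 →
      ∃ g : Fin 2 → Obs → Bool,
        Consistent PhiMinus (fun _ => ({A, B} : Set Obs)) g ∧ ∀ i, g i (c i) = o i) := by
  exact ⟨main_aux 1 (by simp) (by simp) PhiPlus jp_plus A B,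
    main_aux (-1) (by simp) (by simp) PhiMinus jp_minus A B⟩
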